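/- arXiv:2203.09342 — 2 statements merged into one kernel-verified Lean document; each statement's English description precedes it below -/
import Mathlib

section
/- For every S_n-invariant element x of the splitting algebra A_f, both 2·x and D_f·x lie in the image of algebraMap A A_f. -/
open MvPolynomial

noncomputable section

/-- The ideal defining the splitting algebra of `f = Xⁿ + a₁Xⁿ⁻¹ + ⋯ + aₙ`. -/
def splittingIdeal (A : Type*) [CommRing A] (n : ℕ) (a : Fin n → A) :
    Ideal (MvPolynomial (Fin n) A) :=
  Ideal.span (Set.range fun k : Fin n =>
    esymm (Fin n) A (k.1 + 1) - C ((-1 : A) ^ (k.1 + 1) * a k))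

/-- The splitting algebra `A_f`. -/
abbrev SplittingAlg (A : Type*) [CommRing A] (n : ℕ) (a : Fin n → A) : Type _ :=
  MvPolynomial (Fin n) A ⧸ splittingIdeal A n a

/-- The quotient map `π`. -/
def splittingMk (A : Type*) [CommRing A] (n : ℕ) (a : Fin n → A) :
    MvPolynomial (Fin n) A →ₐ[A] SplittingAlg A n a :=
  Ideal.Quotient.mkₐ A (splittingIdeal A n a)

/-- The universal roots `τᵢ`. -/
def tau (A : Type*) [CommRing A] (n : ℕ) (a : Fin n → A) (i : Fin n) :
    SplittingAlg A n a :=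
  splittingMk A n a (X i)

theorem rename_mem_splittingIdeal (A : Type*) [CommRing A] (n : ℕ) (a : Fin n → A)
    (σ : Equiv.Perm (Fin n)) {p : MvPolynomial (Fin n) A}
    (hp : p ∈ splittingIdeal A n a) :
    rename (σ : Fin n → Fin n) p ∈ splittingIdeal A n a := by
  have h : (splittingIdeal A n a).map ((rename (σ : Fin n → Fin n)).toRingHom :
      MvPolynomial (Fin n) A →+* MvPolynomial (Fin n) A) ≤ splittingIdeal A n a := by
    rw [splittingIdeal, Ideal.map_span]
    refine Ideal.span_le.2 ?_
    rintro _ ⟨_, ⟨k, rfl⟩, rfl⟩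
    have hren : (rename (σ : Fin n → Fin n))
        (esymm (Fin n) A (k.1 + 1) - C ((-1 : A) ^ (k.1 + 1) * a k))
        = esymm (Fin n) A (k.1 + 1) - C ((-1 : A) ^ (k.1 + 1) * a k) := by
      rw [map_sub, esymm_isSymmetric (Fin n) A (k.1 + 1) σ, rename_C]
    show (rename (σ : Fin n → Fin n))
        (esymm (Fin n) A (k.1 + 1) - C ((-1 : A) ^ (k.1 + 1) * a k)) ∈ _
    rw [hren]
    exact Ideal.subset_span ⟨k, rfl⟩
  exact h (Ideal.mem_map_of_mem _ hp)

/-- The action of a permutation `σ` on the splitting algebra, as an `A`-algebra map. -/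
def permHom (A : Type*) [CommRing A] (n : ℕ) (a : Fin n → A) (σ : Equiv.Perm (Fin n)) :
    SplittingAlg A n a →ₐ[A] SplittingAlg A n a :=
  Ideal.Quotient.liftₐ (splittingIdeal A n a)
    ((splittingMk A n a).comp (rename (σ : Fin n → Fin n)))
    (fun p hp => by
      have h := rename_mem_splittingIdeal A n a σ hp
      show Ideal.Quotient.mkₐ A (splittingIdeal A n a) _ = 0
      rw [Ideal.Quotient.mkₐ_eq_mk]
      exact (Ideal.Quotient.eq_zero_iff_mem).2 h)

/-- The trivial `G`-invariants of the splitting algebra. -/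
def trivialInv (A : Type*) [CommRing A] (n : ℕ) (a : Fin n → A)
    (G : Subgroup (Equiv.Perm (Fin n))) : Set (SplittingAlg A n a) :=
  splittingMk A n a '' {p | ∀ σ ∈ G, rename (σ : Fin n → Fin n) p = p}

/-- The element `D_f = ∏_{i<j} (τᵢ + τⱼ)`. -/
def Df (A : Type*) [CommRing A] (n : ℕ) (a : Fin n → A) : SplittingAlg A n a :=
  ∏ p ∈ Finset.univ.filter (fun p : Fin n × Fin n => p.1 < p.2),
    (tau A n a p.1 + tau A n a p.2)

end

open Polynomial in
theorem exists_divided_difference {A R : Type*} [CommRing A] [CommRing R] [Algebra A R]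
    {B B' : Subalgebra A R} (hB : B ≤ B') {u v : R} (hu : u ∈ B') (D : R →+ R)
    (hD0 : ∀ c ∈ B, D c = 0) (hDu : ∀ g, D (u * g) = g + v * D g) (d : ℕ) (Q : R[X])
    (hd : Q.natDegree ≤ d) (hQ : ∀ j, Q.coeff j ∈ B) :
    ∃ S : R[X], S.natDegree ≤ d - 1 ∧ (∀ j, S.coeff j ∈ B') ∧
      Q = (Polynomial.X - Polynomial.C u) * S + Polynomial.C (Q.eval u) ∧ D (Q.eval u) = S.eval v := by
  induction d generalizing Q with
  | zero =>
    obtain ⟨c, rfl⟩ := natDegree_eq_zero.1 (Nat.le_zero.1 hd)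
    refine ⟨0, by simp, by simp, by simp, ?_⟩
    simpa using hD0 c (by simpa using hQ 0)
  | succ d ih =>
    obtain ⟨S, hSd, hS, hQS, hDS⟩ := ih Q.divX (by rw [natDegree_divX_eq_natDegree_tsub_one]; omega)
      (fun j => by rw [coeff_divX]; exact hQ _)
    set w := Q.divX.eval u with hw
    have hQX : Q = Polynomial.X * Q.divX + Polynomial.C (Q.coeff 0) := (X_mul_divX_add Q).symm
    have hev : Q.eval u = u * w + Q.coeff 0 := by
      have h := congrArg (Polynomial.eval u) hQX
      simpa only [Polynomial.eval_add, Polynomial.eval_mul, Polynomial.eval_X,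
        Polynomial.eval_C] using h
    have hwB : w ∈ B' := by
      rw [hw, eval_eq_sum_range]
      refine sum_mem fun j _ => mul_mem (hB ?_) (pow_mem hu j)
      rw [coeff_divX]
      exact hQ _
    rcases Nat.eq_zero_or_pos d with rfl | hdpos
    · have hS0 : Q.divX = Polynomial.C w := by
        have h0 : Q.divX.natDegree = 0 := by
          rw [natDegree_divX_eq_natDegree_tsub_one]; omega
        obtain ⟨c, hc⟩ := natDegree_eq_zero.1 h0
        rw [hw, ← hc]; simp
      have hwB0 : w ∈ B := by
        have := hQ 1
        rw [← coeff_divX, hS0] at this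
        simpa using this
      refine ⟨Polynomial.C w, by simp, fun j => ?_, ?_, ?_⟩
      · rw [Polynomial.coeff_C]; split_ifs; exacts [hwB, zero_mem _]
      · conv_lhs => rw [hQX, hS0]
        rw [hev]; simp; ring
      · rw [hev, map_add, hDu, hD0 _ (hQ 0), hD0 _ hwB0]; simp
    · refine ⟨Polynomial.X * S + Polynomial.C w, ?_, fun j => ?_, ?_, ?_⟩
      · refine (natDegree_add_le _ _).trans (max_le ?_ (by simp))
        refine natDegree_mul_le.trans ?_
        have := Polynomial.natDegree_X_le (R := R)
        omega
      · rw [Polynomial.coeff_add, Polynomial.coeff_C]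
        refine add_mem ?_ (by split_ifs; exacts [hwB, zero_mem _])
        cases j with
        | zero => simp
        | succ j => rw [Polynomial.coeff_X_mul]; exact hS j
      · conv_lhs => rw [hQX, hQS]
        rw [hev]; simp; ring
      · rw [hev, map_add, hDu, hD0 _ (hQ 0), hDS]; simp; ring

/-- The subalgebra generated by the first `k` terms of a sequence. -/
noncomputable def adjoinInitial (A : Type*) {R : Type*} [CommRing A] [CommRing R] [Algebra A R] (t : ℕ → R)
    (k : ℕ) : Subalgebra A R :=
  Algebra.adjoin A (t '' Set.Iio k)

section

variable {A R : Type*} [CommRing A] [CommRing R] [Algebra A R] {t : ℕ → R}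

theorem adjoinInitial_mono {k l : ℕ} (h : k ≤ l) : adjoinInitial A t k ≤ adjoinInitial A t l :=
  Algebra.adjoin_mono (Set.image_mono (Set.Iio_subset_Iio h))

theorem mem_adjoinInitial {k l : ℕ} (h : k < l) : t k ∈ adjoinInitial A t l :=
  Algebra.subset_adjoin ⟨k, h, rfl⟩

theorem adjoinInitial_zero : adjoinInitial A t 0 = ⊥ := by
  simp [adjoinInitial]

variable {n : ℕ} (D : ℕ → R →+ R)
  (hD0 : ∀ k, k + 1 < n → ∀ c ∈ adjoinInitial A t k, D k c = 0)
  (hDt : ∀ k, k + 1 < n → ∀ g, D k (t k * g) = g + t (k + 1) * D k g)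

include hD0 hDt

open Polynomial in
theorem eq_zero_of_eval_eq_zero (d k : ℕ) (hk : k + d < n) (Q : R[X]) (hd : Q.natDegree ≤ d)
    (hQ : ∀ j, Q.coeff j ∈ adjoinInitial A t k) (h0 : Q.eval (t k) = 0) : Q = 0 := by
  induction d generalizing k Q with
  | zero =>
    obtain ⟨c, rfl⟩ := natDegree_eq_zero.1 (Nat.le_zero.1 hd)
    simpa using h0
  | succ d ih =>
    obtain ⟨S, hSd, hS, hQS, hDS⟩ := exists_divided_difference
      (adjoinInitial_mono (Nat.le_succ k)) (mem_adjoinInitial (Nat.lt_succ_self k)) (D k)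
      (hD0 k (by omega)) (hDt k (by omega)) (d + 1) Q hd hQ
    have hS0 : S = 0 := ih (k + 1) (by omega) S (by omega) hS (by rw [← hDS, h0, map_zero])
    rw [hQS, hS0, h0]
    simp

open Polynomial in
theorem eval_mem_of_divided_difference_eq_zero (k : ℕ) (hk : k < n) (Q : R[X])
    (hd : Q.natDegree ≤ n - 1 - k) (hQ : ∀ j, Q.coeff j ∈ adjoinInitial A t k)
    (hDQ : k + 1 < n → D k (Q.eval (t k)) = 0) : Q.eval (t k) ∈ adjoinInitial A t k := by
  by_cases hk' : k + 1 < n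
  · obtain ⟨S, hSd, hS, hQS, hDS⟩ := exists_divided_difference
      (adjoinInitial_mono (Nat.le_succ k)) (mem_adjoinInitial (Nat.lt_succ_self k)) (D k)
      (hD0 k hk') (hDt k hk') _ Q hd hQ
    have hS0 : S = 0 := eq_zero_of_eval_eq_zero D hD0 hDt (n - 1 - k - 1) (k + 1) (by omega) S
      hSd hS (by rw [← hDS, hDQ hk'])
    have h := hQ 0
    rw [hQS, hS0] at h
    simpa using h
  · obtain ⟨c, rfl⟩ := natDegree_eq_zero.1 (show Q.natDegree = 0 by omega)
    simpa using hQ 0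

open Polynomial in
theorem mem_adjoinInitial_of_succ (k : ℕ) (hk : k < n)
    (hF : ∏ i ∈ Finset.range n, (Polynomial.X - Polynomial.C (t i)) ∈ lifts (algebraMap A R)) {x : R}
    (hx : x ∈ adjoinInitial A t (k + 1)) (hDx : k + 1 < n → D k x = 0) :
    x ∈ adjoinInitial A t k := by
  nontriviality R
  set B := adjoinInitial A t k with hB
  obtain ⟨F, hF⟩ := (Polynomial.mem_lifts _).1 hF
  let E : B[X] := ∏ i : Finset.range k,
    (Polynomial.X - Polynomial.C ⟨t i, mem_adjoinInitial (Finset.mem_range.1 i.2)⟩)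
  have hE : E.Monic := monic_prod_of_monic _ _ fun i _ => monic_X_sub_C _
  have hEmap : E.map (algebraMap B R) = ∏ i ∈ Finset.range k, (Polynomial.X - Polynomial.C (t i)) := by
    rw [← Finset.prod_coe_sort]
    simp [E, Polynomial.map_prod]
  let G : B[X] := F.map (algebraMap A B) /ₘ E
  have hGmap : G.map (algebraMap B R) = ∏ i ∈ Finset.Ico k n, (Polynomial.X - Polynomial.C (t i)) := by
    rw [Polynomial.map_divByMonic _ hE, Polynomial.map_map, ← IsScalarTower.algebraMap_eq, hF, hEmap,
      ← Finset.prod_range_mul_prod_Ico _ hk.le]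
    exact mul_divByMonic_cancel_left _ (monic_prod_of_monic _ _ fun i _ => monic_X_sub_C _)
  have hinj : Function.Injective (algebraMap B R) := Subtype.val_injective
  have hG : G.Monic := by
    refine monic_of_injective hinj ?_
    rw [hGmap]
    exact monic_prod_of_monic _ _ fun i _ => monic_X_sub_C _
  have hGd : G.natDegree = n - k := by
    rw [← natDegree_map_eq_of_injective hinj, hGmap, natDegree_prod_of_monic _ _
      fun i _ => monic_X_sub_C _]
    simp
  have hG0 : aeval (t k) G = 0 := by
    rw [← Polynomial.eval_map_algebraMap, hGmap, Polynomial.eval_prod]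
    exact Finset.prod_eq_zero (Finset.mem_Ico.2 ⟨le_rfl, hk⟩) (by simp)
  obtain ⟨Q, hQ⟩ : ∃ Q : B[X], aeval (t k) Q = x := by
    change x ∈ (aeval (R := B) (t k)).range.restrictScalars A
    refine Algebra.adjoin_le ?_ hx
    rintro _ ⟨i, hi, rfl⟩
    rcases Nat.lt_succ_iff_lt_or_eq.1 hi with h | rfl
    · exact ⟨Polynomial.C ⟨t i, mem_adjoinInitial h⟩, by simp⟩
    · exact ⟨Polynomial.X, by simp⟩
  have hev : ((Q %ₘ G).map (algebraMap B R)).eval (t k) = x := by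
    rw [Polynomial.eval_map_algebraMap, ← hQ]
    conv_rhs => rw [← modByMonic_add_div Q G]
    simp [hG0]
  rw [← hev] at hDx ⊢
  refine eval_mem_of_divided_difference_eq_zero D hD0 hDt k hk _ ?_ ?_ hDx
  · refine natDegree_map_le.trans ?_
    have := natDegree_modByMonic_lt Q hG (by rintro h; rw [h, natDegree_one] at hGd; omega)
    omega
  · intro j
    rw [Polynomial.coeff_map]
    exact ((Q %ₘ G).coeff j).2

open Polynomial in
theorem mem_bot_of_divided_difference_eq_zero
    (hF : ∏ i ∈ Finset.range n, (Polynomial.X - Polynomial.C (t i)) ∈ lifts (algebraMap A R)) {x : R}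
    (hx : x ∈ adjoinInitial A t n) (hDx : ∀ k, k + 1 < n → D k x = 0) :
    x ∈ (⊥ : Subalgebra A R) := by
  rw [← adjoinInitial_zero (t := t)]
  exact Nat.decreasingInduction (motive := fun k _ => x ∈ adjoinInitial A t k)
    (fun k hk h => mem_adjoinInitial_of_succ D hD0 hDt k hk hF h (hDx k)) hx (Nat.zero_le n)

end

section

variable {A : Type*} [CommRing A] {σ : Type*} [DecidableEq σ]

theorem isRegular_X_sub_X {i j : σ} (hij : i ≠ j) :
    IsRegular (X i - X j : MvPolynomial σ A) := by
  have hleft : IsLeftRegular (X i - X j : MvPolynomial σ A) := by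
    let φ : MvPolynomial σ A →ₐ[A] MvPolynomial σ A :=
      aeval fun k => if k = i then X i + X j else X k
    let ψ : MvPolynomial σ A →ₐ[A] MvPolynomial σ A :=
      aeval fun k => if k = i then X i - X j else X k
    have hψφ : ψ.comp φ = AlgHom.id A _ := by
      ext k : 1
      by_cases hk : k = i
      · subst hk; simp [φ, ψ, hij.symm]
      · simp [φ, ψ, hk]
    have hinj : Function.Injective φ :=
      Function.LeftInverse.injective (g := ψ) fun p => DFunLike.congr_fun hψφ p
    intro p q hpq
    apply hinj
    apply (isRegular_X (n := i)).left
    have h := congrArg φ hpq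
    simpa [φ, hij.symm] using h
  exact (Commute.isRegular_iff (fun p => Commute.all _ p)).2 hleft

theorem exists_X_sub_X_mul_eq (i j : σ) (p : MvPolynomial σ A) :
    ∃ q, (X i - X j) * q = p - rename (Equiv.swap i j) p := by
  induction p using MvPolynomial.induction_on with
  | C a => exact ⟨0, by simp⟩
  | add p q hp hq =>
    obtain ⟨p', hp⟩ := hp
    obtain ⟨q', hq⟩ := hq
    exact ⟨p' + q', by rw [mul_add, hp, hq, map_add]; ring⟩
  | mul_X p k hp =>
    obtain ⟨p', hp⟩ := hp
    rcases eq_or_ne k i with rfl | hki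
    · exact ⟨p' * X j + p, by
        simp only [map_mul, rename_X, Equiv.swap_apply_left]
        linear_combination X j * hp⟩
    rcases eq_or_ne k j with rfl | hkj
    · exact ⟨p' * X i - p, by
        simp only [map_mul, rename_X, Equiv.swap_apply_right]
        linear_combination X i * hp⟩
    · exact ⟨p' * X k, by
        simp only [map_mul, rename_X, Equiv.swap_apply_of_ne_of_ne hki hkj]
        linear_combination X k * hp⟩

/-- The divided difference `(p - s p) / (Xᵢ - Xⱼ)`, where `s` swaps `Xᵢ` and `Xⱼ`. -/
noncomputable def dividedDifference (i j : σ) (p : MvPolynomial σ A) : MvPolynomial σ A :=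
  (exists_X_sub_X_mul_eq i j p).choose

theorem X_sub_X_mul_dividedDifference (i j : σ) (p : MvPolynomial σ A) :
    (X i - X j) * dividedDifference i j p = p - rename (Equiv.swap i j) p :=
  (exists_X_sub_X_mul_eq i j p).choose_spec

variable {i j : σ}

theorem dividedDifference_eq (hij : i ≠ j) {p q : MvPolynomial σ A}
    (h : (X i - X j) * q = p - rename (Equiv.swap i j) p) : dividedDifference i j p = q :=
  (isRegular_X_sub_X hij).left ((X_sub_X_mul_dividedDifference i j p).trans h.symm)

theorem dividedDifference_add (hij : i ≠ j) (p q : MvPolynomial σ A) :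
    dividedDifference i j (p + q) = dividedDifference i j p + dividedDifference i j q :=
  dividedDifference_eq hij (by
    rw [map_add]
    linear_combination X_sub_X_mul_dividedDifference i j p + X_sub_X_mul_dividedDifference i j q)

theorem dividedDifference_mul (hij : i ≠ j) (p q : MvPolynomial σ A) :
    dividedDifference i j (p * q) =
      dividedDifference i j p * q + rename (Equiv.swap i j) p * dividedDifference i j q :=
  dividedDifference_eq hij (by
    rw [map_mul]
    linear_combination q * X_sub_X_mul_dividedDifference i j p +
      rename (Equiv.swap i j) p * X_sub_X_mul_dividedDifference i j q)

theorem dividedDifference_of_rename_eq (hij : i ≠ j) {p : MvPolynomial σ A}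
    (h : rename (Equiv.swap i j) p = p) : dividedDifference i j p = 0 :=
  dividedDifference_eq hij (by rw [h]; ring)

theorem dividedDifference_X (hij : i ≠ j) :
    dividedDifference i j (X i : MvPolynomial σ A) = 1 :=
  dividedDifference_eq hij (by simp)

theorem dividedDifference_dividedDifference (hij : i ≠ j) (p : MvPolynomial σ A) :
    dividedDifference i j (dividedDifference i j p) = 0 := by
  refine dividedDifference_of_rename_eq hij (dividedDifference_eq hij ?_).symm
  have h := congrArg (rename (Equiv.swap i j)) (X_sub_X_mul_dividedDifference i j p)
  have hs : rename (Equiv.swap i j) (rename (Equiv.swap i j) p) = p := by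
    rw [rename_rename, ← Equiv.coe_trans]; simp
  simp only [map_mul, map_sub, rename_X, Equiv.swap_apply_left, Equiv.swap_apply_right, hs] at h
  linear_combination -h

end

section

variable {A : Type*} [CommRing A] {n : ℕ} {a : Fin n → A}

theorem dividedDifference_mem_splittingIdeal {i j : Fin n} (hij : i ≠ j)
    {p : MvPolynomial (Fin n) A} (hp : p ∈ splittingIdeal A n a) :
    dividedDifference i j p ∈ splittingIdeal A n a := by
  unfold splittingIdeal at hp
  induction hp using Submodule.span_induction with
  | mem p hp =>
    obtain ⟨k, rfl⟩ := hp
    rw [dividedDifference_of_rename_eq hij]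
    · exact zero_mem _
    · rw [map_sub, esymm_isSymmetric (Fin n) A (k.1 + 1) _, rename_C]
  | zero => rw [dividedDifference_of_rename_eq hij (map_zero _)]; exact zero_mem _
  | add p q _ _ hp hq => rw [dividedDifference_add hij]; exact add_mem hp hq
  | smul r p hp' hp =>
    rw [smul_eq_mul, dividedDifference_mul hij]
    exact add_mem (Ideal.mul_mem_left _ _ hp') (Ideal.mul_mem_left _ _ hp)

theorem splittingMk_surjective : Function.Surjective (splittingMk A n a) :=
  Ideal.Quotient.mkₐ_surjective A _

theorem permHom_splittingMk (σ : Equiv.Perm (Fin n)) (p : MvPolynomial (Fin n) A) :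
    permHom A n a σ (splittingMk A n a p) = splittingMk A n a (rename σ p) := rfl

theorem exists_splittingAlg_dividedDifference (a : Fin n → A) {i j : Fin n} (hij : i ≠ j) :
    ∃ D : SplittingAlg A n a →+ SplittingAlg A n a,
      ∀ p, D (splittingMk A n a p) = splittingMk A n a (dividedDifference i j p) :=
  let d : MvPolynomial (Fin n) A →+ MvPolynomial (Fin n) A :=
    AddMonoidHom.mk' (dividedDifference i j) (dividedDifference_add hij)
  ⟨QuotientAddGroup.map (splittingIdeal A n a).toAddSubgroup (splittingIdeal A n a).toAddSubgroup d
    fun _ hp => dividedDifference_mem_splittingIdeal hij hp, fun _ => rfl⟩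

/-- The divided difference operator on the splitting algebra attached to two distinct roots. -/
noncomputable def splittingDividedDifference (a : Fin n → A) {i j : Fin n} (hij : i ≠ j) :
    SplittingAlg A n a →+ SplittingAlg A n a :=
  (exists_splittingAlg_dividedDifference a hij).choose

variable {i j : Fin n} (hij : i ≠ j)

theorem splittingDividedDifference_mk (p : MvPolynomial (Fin n) A) :
    splittingDividedDifference a hij (splittingMk A n a p) =
      splittingMk A n a (dividedDifference i j p) :=
  (exists_splittingAlg_dividedDifference a hij).choose_spec p

theorem splittingDividedDifference_mul (x y : SplittingAlg A n a) :
    splittingDividedDifference a hij (x * y) = splittingDividedDifference a hij x * y +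
      permHom A n a (Equiv.swap i j) x * splittingDividedDifference a hij y := by
  obtain ⟨p, rfl⟩ := splittingMk_surjective x
  obtain ⟨q, rfl⟩ := splittingMk_surjective y
  rw [← map_mul, splittingDividedDifference_mk, dividedDifference_mul hij, permHom_splittingMk]
  simp only [splittingDividedDifference_mk, map_add, map_mul]

theorem splittingDividedDifference_tau_mul (x : SplittingAlg A n a) :
    splittingDividedDifference a hij (tau A n a i * x) =
      x + tau A n a j * splittingDividedDifference a hij x := by
  rw [splittingDividedDifference_mul, tau, splittingDividedDifference_mk,
    dividedDifference_X hij, permHom_splittingMk, rename_X, Equiv.swap_apply_left, map_one,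
    one_mul, tau]

theorem tau_sub_tau_mul_splittingDividedDifference (x : SplittingAlg A n a) :
    (tau A n a i - tau A n a j) * splittingDividedDifference a hij x =
      x - permHom A n a (Equiv.swap i j) x := by
  obtain ⟨p, rfl⟩ := splittingMk_surjective x
  rw [splittingDividedDifference_mk, permHom_splittingMk, ← map_sub,
    ← X_sub_X_mul_dividedDifference, map_mul, map_sub, tau, tau]

theorem splittingDividedDifference_self_comp (x : SplittingAlg A n a) :
    splittingDividedDifference a hij (splittingDividedDifference a hij x) = 0 := by
  obtain ⟨p, rfl⟩ := splittingMk_surjective x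
  rw [splittingDividedDifference_mk, splittingDividedDifference_mk,
    dividedDifference_dividedDifference hij, map_zero]

theorem two_mul_and_add_mul_splittingDividedDifference {x : SplittingAlg A n a}
    (hx : permHom A n a (Equiv.swap i j) x = x) :
    2 * splittingDividedDifference a hij x = 0 ∧
      (tau A n a i + tau A n a j) * splittingDividedDifference a hij x = 0 := by
  set y := splittingDividedDifference a hij x with hy
  have hyy : splittingDividedDifference a hij y = 0 := splittingDividedDifference_self_comp hij x
  have h0 : (tau A n a i - tau A n a j) * y = 0 := by
    rw [tau_sub_tau_mul_splittingDividedDifference, hx, sub_self]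
  have hτy : splittingDividedDifference a hij (tau A n a i * y) = y := by
    rw [splittingDividedDifference_tau_mul, hyy]; ring
  have hτjy : tau A n a j * y = tau A n a i * y := by linear_combination -h0
  have hswap : splittingDividedDifference a hij (tau A n a j * y) = -y := by
    have hsum : splittingDividedDifference a hij (tau A n a i + tau A n a j) = 0 := by
      rw [tau, tau, ← map_add, splittingDividedDifference_mk, dividedDifference_of_rename_eq hij,
        map_zero]
      simp [add_comm]
    have h := splittingDividedDifference_mul hij (tau A n a i + tau A n a j) y
    rw [hsum, hyy, add_mul, map_add, hτy] at h
    linear_combination h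
  have h2 : 2 * y = 0 := by
    rw [hτjy, hτy] at hswap
    linear_combination hswap
  exact ⟨h2, by linear_combination tau A n a i * h2 - h0⟩

end

theorem prod_lt_perm {M ι : Type*} [CommMonoid M] [Fintype ι] [LinearOrder ι] (f : ι → ι → M)
    (hf : ∀ i j, f i j = f j i) (σ : Equiv.Perm ι) :
    ∏ p ∈ Finset.univ.filter (fun p : ι × ι => p.1 < p.2), f (σ p.1) (σ p.2) =
      ∏ p ∈ Finset.univ.filter (fun p : ι × ι => p.1 < p.2), f p.1 p.2 := by
  have key : ∀ (τ : Equiv.Perm ι) (p : ι × ι), p.1 < p.2 →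
      min (τ p.1) (τ p.2) < max (τ p.1) (τ p.2) := fun τ p hp => by
    simpa using hp.ne'
  have inv : ∀ (τ : Equiv.Perm ι) (p : ι × ι), p.1 < p.2 →
      (min (τ.symm (min (τ p.1) (τ p.2))) (τ.symm (max (τ p.1) (τ p.2))),
        max (τ.symm (min (τ p.1) (τ p.2))) (τ.symm (max (τ p.1) (τ p.2)))) = p := fun τ p hp => by
    rcases le_total (τ p.1) (τ p.2) with h | h <;> simp [h, hp.le]
  refine Finset.prod_bij' (fun p _ => (min (σ p.1) (σ p.2), max (σ p.1) (σ p.2)))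
    (fun p _ => (min (σ.symm p.1) (σ.symm p.2), max (σ.symm p.1) (σ.symm p.2))) ?_ ?_ ?_ ?_ ?_
  · intro p hp
    simpa using key σ p (by simpa using hp)
  · intro p hp
    simpa using key σ.symm p (by simpa using hp)
  · intro p hp
    exact inv σ p (by simpa using hp)
  · intro p hp
    simpa using inv σ.symm p (by simpa using hp)
  · intro p _
    rcases le_total (σ p.1) (σ p.2) with h | h
    · simp [h]
    · simp [h, hf (σ p.1)]

section

variable {A : Type*} [CommRing A] {n : ℕ} {a : Fin n → A}

theorem splittingDividedDifference_Df {i j : Fin n} (hij : i ≠ j) :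
    splittingDividedDifference a hij (Df A n a) = 0 := by
  have h : Df A n a = splittingMk A n a
      (∏ p ∈ Finset.univ.filter (fun p : Fin n × Fin n => p.1 < p.2), (X p.1 + X p.2)) := by
    simp [Df, tau]
  rw [h, splittingDividedDifference_mk, dividedDifference_of_rename_eq hij, map_zero]
  rw [map_prod]
  simp only [map_add, rename_X]
  exact prod_lt_perm (fun i j => (X i + X j : MvPolynomial (Fin n) A)) (fun _ _ => add_comm _ _) _

theorem tau_add_tau_dvd_Df {i j : Fin n} (hij : i < j) :
    tau A n a i + tau A n a j ∣ Df A n a := by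
  have h : (i, j) ∈ Finset.univ.filter (fun p : Fin n × Fin n => p.1 < p.2) := by simpa using hij
  rw [Df, ← Finset.mul_prod_erase _ _ h]
  exact dvd_mul_right _ _

open Polynomial in
theorem prod_X_sub_C_tau_mem_lifts :
    ∏ i, (Polynomial.X - Polynomial.C (tau A n a i)) ∈
      lifts (algebraMap A (SplittingAlg A n a)) := by
  have hs : ∏ i, (Polynomial.X - Polynomial.C (tau A n a i)) =
      ((Finset.univ.val.map (tau A n a)).map fun t => Polynomial.X - Polynomial.C t).prod := by
    rw [Multiset.map_map]; rfl
  rw [hs, Multiset.prod_X_sub_X_eq_sum_esymm]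
  refine sum_mem fun j hj => ?_
  have hcoeff : (Finset.univ.val.map (tau A n a)).esymm j ∈
      Set.range (algebraMap A (SplittingAlg A n a)) := by
    have htau : splittingMk A n a = MvPolynomial.aeval (tau A n a) := by
      ext i; simp [tau]
    rw [← aeval_esymm_eq_multiset_esymm (Fin n) A, ← htau]
    cases j with
    | zero => exact ⟨1, by simp⟩
    | succ k =>
      have hk : k < n := by simpa using hj
      refine ⟨(-1 : A) ^ (k + 1) * a ⟨k, hk⟩, ?_⟩
      rw [← AlgHom.commutes (splittingMk A n a)]
      have hmem : esymm (Fin n) A (k + 1) - algebraMap A _ ((-1 : A) ^ (k + 1) * a ⟨k, hk⟩) ∈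
          splittingIdeal A n a := Ideal.subset_span (Set.mem_range_self (⟨k, hk⟩ : Fin n))
      exact (Ideal.Quotient.eq.2 hmem).symm
  obtain ⟨c, hc⟩ := hcoeff
  rw [← hc]
  exact ⟨(-1) ^ j * (Polynomial.C c * Polynomial.X ^ (n - j)), by simp⟩

theorem splittingDividedDifference_algebraMap {i j : Fin n} (hij : i ≠ j) (c : A) :
    splittingDividedDifference a hij (algebraMap A _ c) = 0 := by
  rw [← AlgHom.commutes (splittingMk A n a), splittingDividedDifference_mk,
    dividedDifference_of_rename_eq hij (by simp), map_zero]

theorem splittingDividedDifference_tau_of_ne {i j k : Fin n} (hij : i ≠ j) (hi : k ≠ i)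
    (hj : k ≠ j) : splittingDividedDifference a hij (tau A n a k) = 0 := by
  rw [tau, splittingDividedDifference_mk, dividedDifference_of_rename_eq hij, map_zero]
  rw [rename_X, Equiv.swap_apply_of_ne_of_ne hi hj]

/-- An element killed by all the divided differences is a scalar. -/
theorem mem_range_of_splittingDividedDifference_eq_zero {x : SplittingAlg A n a}
    (hx : ∀ (i j : Fin n) (hij : i < j), splittingDividedDifference a hij.ne x = 0) :
    x ∈ Set.range (algebraMap A (SplittingAlg A n a)) := by
  let t : ℕ → SplittingAlg A n a := fun k => if h : k < n then tau A n a ⟨k, h⟩ else 0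
  let D : ℕ → SplittingAlg A n a →+ SplittingAlg A n a := fun k =>
    if h : k + 1 < n then
      splittingDividedDifference a (i := ⟨k, by omega⟩) (j := ⟨k + 1, h⟩) (by simp)
    else 0
  have ht (i : Fin n) : t i = tau A n a i := by simp [t]
  refine Algebra.mem_bot.1 (mem_bot_of_divided_difference_eq_zero (t := t) (n := n) D
    ?_ ?_ ?_ ?_ ?_)
  · intro k hk c hc
    simp only [D, dif_pos hk]
    refine Algebra.adjoin_induction ?_ ?_ ?_ ?_ hc
    · rintro _ ⟨l, hl : l < k, rfl⟩
      simp only [t, dif_pos (show l < n by omega)]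
      exact splittingDividedDifference_tau_of_ne _ (by simp; omega) (by simp; omega)
    · exact fun c => splittingDividedDifference_algebraMap _ c
    · intro x y _ _ hx hy
      rw [map_add, hx, hy, add_zero]
    · intro x y _ _ hx hy
      rw [splittingDividedDifference_mul, hx, hy, zero_mul, mul_zero, add_zero]
  · intro k hk g
    simp only [D, t, dif_pos hk, dif_pos (show k < n by omega)]
    exact splittingDividedDifference_tau_mul _ g
  · rw [← Fin.prod_univ_eq_prod_range fun i => Polynomial.X - Polynomial.C (t i)]
    simp only [ht]
    exact prod_X_sub_C_tau_mem_lifts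
  · obtain ⟨p, rfl⟩ := splittingMk_surjective x
    have hp : splittingMk A n a p ∈ (adjoinInitial A t n).toSubmodule := by
      clear hx
      induction p using MvPolynomial.induction_on with
      | C c =>
        exact (AlgHom.commutes (splittingMk A n a) c).symm ▸ Subalgebra.algebraMap_mem _ c
      | add p q hp hq => rw [map_add]; exact add_mem hp hq
      | mul_X p i hp =>
        rw [map_mul]
        have hi : splittingMk A n a (X i) ∈ adjoinInitial A t n := by
          rw [← tau, ← ht i]
          exact mem_adjoinInitial i.2
        exact mul_mem (S := Subalgebra A _) hp hi
    exact hp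
  · intro k hk
    simp only [D, dif_pos hk]
    exact hx _ _ (by simp)

end

/-- For every `S_n`-invariant `x` of `A_f`, both `2·x` and `D_f·x` lie in the image
of `algebraMap A A_f`. -/
theorem two_mul_and_Df_mul_invariant_mem_range (A : Type*) [CommRing A] (n : ℕ) (hn : 1 ≤ n)
    (a : Fin n → A) (x : SplittingAlg A n a)
    (hx : ∀ σ : Equiv.Perm (Fin n), permHom A n a σ x = x) :
    2 * x ∈ Set.range (algebraMap A (SplittingAlg A n a)) ∧
    Df A n a * x ∈ Set.range (algebraMap A (SplittingAlg A n a)) := by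
  constructor
  · refine mem_range_of_splittingDividedDifference_eq_zero fun i j hij => ?_
    rw [two_mul, map_add, ← two_mul]
    exact (two_mul_and_add_mul_splittingDividedDifference hij.ne (hx _)).1
  · refine mem_range_of_splittingDividedDifference_eq_zero fun i j hij => ?_
    obtain ⟨e, he⟩ := tau_add_tau_dvd_Df (a := a) hij
    rw [mul_comm, splittingDividedDifference_mul, splittingDividedDifference_Df, mul_zero,
      add_zero, he]
    linear_combination
      e * (two_mul_and_add_mul_splittingDividedDifference hij.ne (hx (Equiv.swap i j))).2
end

section
/- If every a ∈ A satisfying 2·a = 0 and (algebraMap A A_f a)·D_f = 0 equals 0, then every S_n-invariant element of the splitting algebra A_f lies in the image of algebraMap A A_f. -/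
open MvPolynomial

/-- The monic polynomial `Xⁿ + a₁Xⁿ⁻¹ + ⋯ + aₙ`. -/
noncomputable def coeffPoly (A : Type*) [CommRing A] (n : ℕ) (a : Fin n → A) : Polynomial A :=
  Polynomial.X ^ n + ∑ k : Fin n, Polynomial.C (a k) * Polynomial.X ^ (n - 1 - k.1)

section CoeffPoly

variable {A : Type*} [CommRing A] {n : ℕ} (a : Fin n → A)

theorem degree_sum_coeffs_lt :
    (∑ k : Fin n, Polynomial.C (a k) * Polynomial.X ^ (n - 1 - k.1)).degree < (n : WithBot ℕ) := by
  refine (Polynomial.degree_sum_le _ _).trans_lt ?_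
  refine (Finset.sup_lt_iff (WithBot.bot_lt_coe n)).2 fun k _ => ?_
  refine (Polynomial.degree_C_mul_X_pow_le _ _).trans_lt ?_
  have := k.2
  exact Nat.cast_lt.2 (by omega)

theorem coeffPoly_monic : (coeffPoly A n a).Monic :=
  Polynomial.monic_X_pow_add (degree_sum_coeffs_lt a)

theorem coeffPoly_natDegree [Nontrivial A] : (coeffPoly A n a).natDegree = n := by
  refine Polynomial.natDegree_eq_of_degree_eq_some ?_
  rw [coeffPoly, Polynomial.degree_add_eq_left_of_degree_lt, Polynomial.degree_X_pow]
  rw [Polynomial.degree_X_pow]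
  exact degree_sum_coeffs_lt a

theorem coeffPoly_coeff (k : Fin n) : (coeffPoly A n a).coeff (n - 1 - k.1) = a k := by
  have hk := k.2
  rw [coeffPoly, Polynomial.coeff_add, Polynomial.coeff_X_pow, if_neg (by omega), zero_add,
    Polynomial.finsetSum_coeff, Finset.sum_eq_single k]
  · simp
  · intro j _ hj
    have := j.2
    rw [Polynomial.coeff_C_mul, Polynomial.coeff_X_pow, if_neg, mul_zero]
    intro h
    exact hj (Fin.ext (by omega))
  · simp

theorem coeffPoly_of_monic {p : Polynomial A} (hp : p.Monic) (hn : p.natDegree = n) :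
    coeffPoly A n (fun k => p.coeff (n - 1 - k.1)) = p := by
  subst hn
  conv_rhs => rw [hp.as_sum]
  rw [coeffPoly, ← Finset.sum_range_reflect, ← Fin.sum_univ_eq_sum_range
    (fun j => Polynomial.C (p.coeff (p.natDegree - 1 - j)) *
      Polynomial.X ^ (p.natDegree - 1 - j))]

theorem prod_X_sub_C_eq_map_coeffPoly_iff {R : Type*} [CommRing R] (φ : A →+* R) (r : Fin n → R) :
    ∏ i, (Polynomial.X - Polynomial.C (r i)) = (coeffPoly A n a).map φ ↔
      ∀ k : Fin n, (Finset.univ.val.map r).esymm (k.1 + 1) = φ ((-1) ^ (k.1 + 1) * a k) := by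
  have key : ∀ k : Fin n, (∏ i, (Polynomial.X - Polynomial.C (r i))).coeff (n - 1 - k.1) =
      (-1) ^ (k.1 + 1) * (Finset.univ.val.map r).esymm (k.1 + 1) := by
    intro k
    have hk := k.2
    have h := Multiset.prod_X_sub_C_coeff (Finset.univ.val.map r) (k := n - 1 - k.1) (by simp; omega)
    rw [Multiset.map_map] at h
    have e : n - (n - 1 - k.1) = k.1 + 1 := by omega
    simp only [Multiset.card_map, Finset.card_val, Finset.card_univ, Fintype.card_fin, e] at h
    exact h
  have sq : ∀ k : ℕ, ((-1 : R) ^ k) * (-1) ^ k = 1 := fun k => by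
    rw [← mul_pow]; simp
  constructor
  · intro h k
    have := key k
    rw [h, Polynomial.coeff_map, coeffPoly_coeff] at this
    rw [map_mul, this, map_pow, map_neg, map_one, ← mul_assoc, sq, one_mul]
  · intro h
    nontriviality R
    have hm : (∏ i, (Polynomial.X - Polynomial.C (r i))).Monic :=
      Polynomial.monic_prod_of_monic _ _ fun i _ => Polynomial.monic_X_sub_C _
    have hd : (∏ i, (Polynomial.X - Polynomial.C (r i))).natDegree = n := by simp
    rw [← coeffPoly_of_monic hm hd]
    simp only [key, h, coeffPoly, Polynomial.map_add, Polynomial.map_pow, Polynomial.map_X,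
      Polynomial.map_sum, Polynomial.map_mul, Polynomial.map_C, map_mul, map_pow, map_neg, map_one]
    congr 1
    refine Finset.sum_congr rfl fun k _ => ?_
    rw [← mul_assoc ((-1) ^ (k.1 + 1)), ← mul_pow, neg_one_mul, neg_neg, one_pow, one_mul]

theorem splittingMk_esymm (k : Fin n) : splittingMk A n a (esymm (Fin n) A (k.1 + 1)) =
    algebraMap A (SplittingAlg A n a) ((-1 : A) ^ (k.1 + 1) * a k) := by
  rw [← AlgHom.commutes (splittingMk A n a), MvPolynomial.algebraMap_eq]
  exact Ideal.Quotient.eq.2 (Ideal.subset_span ⟨k, rfl⟩)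

theorem prod_X_sub_tau :
    ∏ i, (Polynomial.X - Polynomial.C (tau A n a i)) =
      (coeffPoly A n a).map (algebraMap A (SplittingAlg A n a)) := by
  rw [prod_X_sub_C_eq_map_coeffPoly_iff]
  intro k
  have h : (Finset.univ.val.map (tau A n a)).esymm (k.1 + 1) =
      splittingMk A n a (esymm (Fin n) A (k.1 + 1)) := by
    rw [Finset.esymm_map_val]
    simp only [esymm, map_sum, map_prod]
    rfl
  rw [h, splittingMk_esymm]

/-- The universal property of the splitting algebra. -/
noncomputable def splittingLift {R : Type*} [CommRing R] (φ : A →+* R) (r : Fin n → R)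
    (h : ∏ i, (Polynomial.X - Polynomial.C (r i)) = (coeffPoly A n a).map φ) :
    SplittingAlg A n a →+* R :=
  Ideal.Quotient.lift (splittingIdeal A n a) (eval₂Hom φ r) (by
    change splittingIdeal A n a ≤ RingHom.ker (eval₂Hom φ r)
    rw [splittingIdeal, Ideal.span_le]
    rintro _ ⟨k, rfl⟩
    have := (prod_X_sub_C_eq_map_coeffPoly_iff a φ r).1 h k
    rw [SetLike.mem_coe, RingHom.mem_ker, map_sub, sub_eq_zero, coe_eval₂Hom, eval₂_C, ← this]
    rw [Finset.esymm_map_val]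
    simp [esymm])

section Lift

variable {R : Type*} [CommRing R] (φ : A →+* R) (r : Fin n → R)
  (h : ∏ i, (Polynomial.X - Polynomial.C (r i)) = (coeffPoly A n a).map φ)

theorem splittingLift_tau (i : Fin n) : splittingLift a φ r h (tau A n a i) = r i := by
  change eval₂Hom φ r (X i) = r i
  simp

theorem splittingLift_algebraMap (c : A) :
    splittingLift a φ r h (algebraMap A (SplittingAlg A n a) c) = φ c := by
  change eval₂Hom φ r (C c) = φ c
  simp

end Lift

theorem splitting_ringHom_ext {R : Type*} [CommRing R] {φ ψ : SplittingAlg A n a →+* R}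
    (h₁ : ∀ c : A, φ (algebraMap A _ c) = ψ (algebraMap A _ c))
    (h₂ : ∀ i, φ (tau A n a i) = ψ (tau A n a i)) : φ = ψ := by
  refine Ideal.Quotient.ringHom_ext (MvPolynomial.ringHom_ext ?_ ?_)
  · exact h₁
  · exact h₂

theorem permHom_tau (σ : Equiv.Perm (Fin n)) (i : Fin n) :
    permHom A n a σ (tau A n a i) = tau A n a (σ i) := by
  change splittingMk A n a (rename σ (X i)) = _
  rw [rename_X]
  rfl

theorem splittingMk_mem_range_of_isSymmetric {p : MvPolynomial (Fin n) A} (hp : p.IsSymmetric) :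
    splittingMk A n a p ∈ (algebraMap A (SplittingAlg A n a)).range := by
  obtain ⟨q, hq⟩ := esymmAlgHom_surjective (R := A) (σ := Fin n) (n := n) (by simp) ⟨p, hp⟩
  have hq' : p = aeval (fun i : Fin n => esymm (Fin n) A (i.1 + 1)) q := by
    rw [← esymmAlgHom_apply, hq]
  refine ⟨aeval (fun k : Fin n => (-1 : A) ^ (k.1 + 1) * a k) q, ?_⟩
  rw [hq', ← AlgHom.comp_apply, comp_aeval]
  simp only [splittingMk_esymm]
  exact (aeval_algebraMap_apply (SplittingAlg A n a) _ q).symm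

theorem isSymmetric_prod_X_add_X :
    (∏ p ∈ Finset.univ.filter (fun p : Fin n × Fin n => p.1 < p.2),
      (X p.1 + X p.2 : MvPolynomial (Fin n) A)).IsSymmetric := by
  have key : ∀ F : Sym2 (Fin n) → MvPolynomial (Fin n) A,
      ∏ p ∈ Finset.univ.filter (fun p : Fin n × Fin n => p.1 < p.2), F s(p.1, p.2) =
        ∏ z ∈ Finset.univ.filter (fun z : Sym2 (Fin n) => ¬ z.IsDiag), F z := by
    intro F
    have h := (Finset.sum_sym2_filter_not_isDiag (M := Additive (MvPolynomial (Fin n) A))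
      Finset.univ F)
    rw [Finset.sym2_univ] at h
    refine Eq.trans ?_ h.symm
    refine Finset.prod_congr ?_ fun _ _ => rfl
    ext p
    simpa using fun h : p.1 < p.2 => h.ne
  intro σ
  let F : Sym2 (Fin n) → MvPolynomial (Fin n) A :=
    Sym2.lift ⟨fun i j => X i + X j, fun i j => add_comm _ _⟩
  have h₁ := key F
  have h₂ := key (fun z => F (z.map σ))
  simp only [F, Sym2.map_mk, Sym2.lift_mk] at h₁ h₂
  rw [map_prod]
  simp only [map_add, rename_X]
  rw [h₁, h₂]
  refine Finset.prod_nbij' (Sym2.map σ) (Sym2.map σ.symm) ?_ ?_ ?_ ?_ fun _ _ => rfl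
  all_goals
    intro z
    induction z with | _ i j => simp

theorem Df_mem_range : Df A n a ∈ (algebraMap A (SplittingAlg A n a)).range := by
  have := splittingMk_mem_range_of_isSymmetric a (isSymmetric_prod_X_add_X (A := A) (n := n))
  rw [map_prod] at this
  simp only [map_add] at this
  exact this

end CoeffPoly

section Tower

variable {A : Type*} [CommRing A] {n : ℕ} (a : Fin (n + 1) → A)

/-- The algebra `A[X]/(f)` obtained by adjoining one root of `f`. -/
abbrev RootAlg : Type _ := AdjoinRoot (coeffPoly A (n + 1) a)

/-- The inclusion of `A` into `A[X]/(f)`. -/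
noncomputable abbrev rootAlgOf : A →+* RootAlg a := AdjoinRoot.of (coeffPoly A (n + 1) a)

/-- The class of `X` in `A[X]/(f)`. -/
noncomputable abbrev rootAlgRoot : RootAlg a := AdjoinRoot.root (coeffPoly A (n + 1) a)

/-- The coefficients of the monic polynomial `f / (X - θ)` over `A[X]/(f)`, `θ` the class of `X`. -/
noncomputable def cofactorCoeffs (k : Fin n) : RootAlg a :=
  ((coeffPoly A (n + 1) a).map (rootAlgOf a) /ₘ
    (Polynomial.X - Polynomial.C (rootAlgRoot a))).coeff (n - 1 - k.1)

theorem X_sub_C_root_mul_cofactor :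
    (Polynomial.X - Polynomial.C (rootAlgRoot a)) * coeffPoly (RootAlg a) n (cofactorCoeffs a) =
      (coeffPoly A (n + 1) a).map (rootAlgOf a) := by
  nontriviality RootAlg a
  have : Nontrivial A := (rootAlgOf a).domain_nontrivial
  have h : (Polynomial.X - Polynomial.C (rootAlgRoot a)) *
      ((coeffPoly A (n + 1) a).map (rootAlgOf a) /ₘ
        (Polynomial.X - Polynomial.C (rootAlgRoot a))) =
      (coeffPoly A (n + 1) a).map (rootAlgOf a) :=
    Polynomial.mul_divByMonic_eq_iff_isRoot.2 (AdjoinRoot.isRoot_root _)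
  have hf : ((coeffPoly A (n + 1) a).map (rootAlgOf a)).Monic := (coeffPoly_monic a).map _
  have hg := (Polynomial.monic_X_sub_C (rootAlgRoot a)).of_mul_monic_left (h ▸ hf)
  have hd := congrArg Polynomial.natDegree h
  rw [(Polynomial.monic_X_sub_C _).natDegree_mul hg, Polynomial.natDegree_X_sub_C,
    (coeffPoly_monic a).natDegree_map, coeffPoly_natDegree] at hd
  rw [show coeffPoly (RootAlg a) n (cofactorCoeffs a) = _ from
    coeffPoly_of_monic hg (by omega), h]

/-- The canonical map from the splitting algebra of `f` over `A` to the splitting algebra of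
`f / (X - θ)` over `A[X]/(f)`. -/
noncomputable def toTower :
    SplittingAlg A (n + 1) a →+* SplittingAlg (RootAlg a) n (cofactorCoeffs a) :=
  splittingLift a ((algebraMap (RootAlg a) _).comp (rootAlgOf a))
    (Fin.cons (algebraMap (RootAlg a) _ (rootAlgRoot a)) (tau (RootAlg a) n (cofactorCoeffs a))) (by
      rw [Fin.prod_univ_succ]
      simp only [Fin.cons_zero, Fin.cons_succ]
      rw [prod_X_sub_tau, ← Polynomial.map_map, ← X_sub_C_root_mul_cofactor]
      simp)

theorem toTower_tau_zero : toTower a (tau A (n + 1) a 0) = algebraMap _ _ (rootAlgRoot a) := by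
  rw [toTower, splittingLift_tau, Fin.cons_zero]

theorem toTower_tau_succ (i : Fin n) :
    toTower a (tau A (n + 1) a i.succ) = tau (RootAlg a) n (cofactorCoeffs a) i := by
  rw [toTower, splittingLift_tau, Fin.cons_succ]

theorem toTower_algebraMap (c : A) :
    toTower a (algebraMap A _ c) = algebraMap (RootAlg a) _ (rootAlgOf a c) := by
  rw [toTower, splittingLift_algebraMap, RingHom.comp_apply]

theorem eval₂_tau_zero :
    (coeffPoly A (n + 1) a).eval₂ (algebraMap A _) (tau A (n + 1) a 0) = 0 := by
  rw [← Polynomial.eval_map, ← prod_X_sub_tau, Polynomial.eval_prod]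
  exact Finset.prod_eq_zero (Finset.mem_univ 0) (by simp)

/-- The map `A[X]/(f) → A_f` sending the class of `X` to the first universal root. -/
noncomputable def rootAlgToSplitting : RootAlg a →+* SplittingAlg A (n + 1) a :=
  AdjoinRoot.lift (algebraMap A _) (tau A (n + 1) a 0) (eval₂_tau_zero a)

theorem rootAlgToSplitting_of (c : A) :
    rootAlgToSplitting a (rootAlgOf a c) = algebraMap A _ c :=
  AdjoinRoot.lift_of (eval₂_tau_zero a)

theorem rootAlgToSplitting_root :
    rootAlgToSplitting a (rootAlgRoot a) = tau A (n + 1) a 0 :=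
  AdjoinRoot.lift_root (eval₂_tau_zero a)

theorem toTower_injective : Function.Injective (toTower a) := by
  have h : ∏ i : Fin n, (Polynomial.X - Polynomial.C (tau A (n + 1) a i.succ)) =
      (coeffPoly (RootAlg a) n (cofactorCoeffs a)).map (rootAlgToSplitting a) := by
    have h₁ := congrArg (Polynomial.map (rootAlgToSplitting a)) (X_sub_C_root_mul_cofactor a)
    have h₂ : (rootAlgToSplitting a).comp (rootAlgOf a) = algebraMap A _ :=
      RingHom.ext (rootAlgToSplitting_of a)
    rw [Polynomial.map_map, h₂, ← prod_X_sub_tau, Fin.prod_univ_succ, Polynomial.map_mul,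
      Polynomial.map_sub, Polynomial.map_X, Polynomial.map_C,
      rootAlgToSplitting_root] at h₁
    exact ((Polynomial.monic_X_sub_C _).isRegular.left h₁).symm
  have hid : (splittingLift _ (rootAlgToSplitting a) _ h).comp (toTower a) = RingHom.id _ := by
    refine splitting_ringHom_ext a (fun c => ?_) (fun i => ?_)
    · rw [RingHom.comp_apply, toTower_algebraMap, splittingLift_algebraMap,
        rootAlgToSplitting_of]
      rfl
    · refine Fin.cases ?_ (fun i => ?_) i
      · rw [RingHom.comp_apply, toTower_tau_zero, splittingLift_algebraMap,
          rootAlgToSplitting_root]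
        rfl
      · rw [RingHom.comp_apply, toTower_tau_succ, splittingLift_tau]
        rfl
  exact Function.LeftInverse.injective fun x => DFunLike.congr_fun hid x

theorem mk_coeffPoly_eq_zero {n : ℕ} (a : Fin n → A) {p : Polynomial A}
    (hp : p.degree < (n : WithBot ℕ)) (h : AdjoinRoot.mk (coeffPoly A n a) p = 0) : p = 0 := by
  nontriviality A
  by_contra hne
  refine AdjoinRoot.mk_ne_zero_of_degree_lt (coeffPoly_monic a) hne ?_ h
  rwa [Polynomial.degree_eq_natDegree (coeffPoly_monic a).ne_zero, coeffPoly_natDegree]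

theorem rootAlgOf_injective : Function.Injective (rootAlgOf a) := by
  refine (injective_iff_map_eq_zero _).2 fun c hc => Polynomial.C_eq_zero.1 ?_
  refine mk_coeffPoly_eq_zero a (Polynomial.degree_C_le.trans_lt ?_) hc
  exact Nat.cast_lt.2 n.succ_pos

theorem eq_zero_of_rootAlgOf_add_mul_root (hn : 1 ≤ n) {b c : A}
    (h : rootAlgOf a b + rootAlgOf a c * rootAlgRoot a = 0) : c = 0 := by
  have hp : Polynomial.C c * Polynomial.X + Polynomial.C b = 0 := by
    refine mk_coeffPoly_eq_zero a (Polynomial.degree_linear_le.trans_lt ?_) ?_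
    · exact Nat.cast_lt.2 (by omega : 1 < n + 1)
    · rw [map_add, map_mul, AdjoinRoot.mk_C, AdjoinRoot.mk_C, AdjoinRoot.mk_X]
      exact (add_comm _ _).trans h
  simpa using congrArg (Polynomial.coeff · 1) hp

end Tower

theorem algebraMap_splittingAlg_injective {A : Type*} [CommRing A] {n : ℕ} (a : Fin n → A) :
    Function.Injective (algebraMap A (SplittingAlg A n a)) := by
  induction n generalizing A with
  | zero =>
    have h : ∏ i : Fin 0, (Polynomial.X - Polynomial.C (Fin.elim0 i : A)) =
        (coeffPoly A 0 a).map (RingHom.id A) := by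
      simp [coeffPoly]
    exact Function.LeftInverse.injective (splittingLift_algebraMap a (RingHom.id A) _ h)
  | succ n ih =>
    refine Function.Injective.of_comp (f := toTower a) ?_
    have : toTower a ∘ algebraMap A _ = algebraMap (RootAlg a) _ ∘ rootAlgOf a :=
      funext (toTower_algebraMap a)
    rw [this]
    exact (ih _).comp (rootAlgOf_injective a)

section Descent

variable {A : Type*} [CommRing A]

theorem Df_dvd_toTower_Df {n : ℕ} (a : Fin (n + 1) → A) :
    Df (RootAlg a) n (cofactorCoeffs a) ∣ toTower a (Df A (n + 1) a) := by
  let e : Fin n × Fin n ↪ Fin (n + 1) × Fin (n + 1) :=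
    (Fin.succEmb n).prodMap (Fin.succEmb n)
  have h : Df (RootAlg a) n (cofactorCoeffs a) = ∏ p ∈ (Finset.univ.filter
      fun p : Fin n × Fin n => p.1 < p.2).map e,
      toTower a (tau A (n + 1) a p.1 + tau A (n + 1) a p.2) := by
    rw [Finset.prod_map]
    refine Finset.prod_congr rfl fun p _ => ?_
    change _ = toTower a (tau A (n + 1) a p.1.succ + tau A (n + 1) a p.2.succ)
    rw [map_add, toTower_tau_succ, toTower_tau_succ]
  rw [h, Df, map_prod]
  refine Finset.prod_dvd_prod_of_subset _ _ _ ?_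
  intro p hp
  obtain ⟨q, hq, rfl⟩ := Finset.mem_map.1 hp
  simpa [e] using hq

theorem ann_descends {n : ℕ} (a : Fin (n + 1) → A)
    (hann : ∀ b : A, 2 * b = 0 → algebraMap A _ b * Df A (n + 1) a = 0 → b = 0)
    (b : RootAlg a) (h₂ : 2 * b = 0)
    (hD : algebraMap _ _ b * Df (RootAlg a) n (cofactorCoeffs a) = 0) : b = 0 := by
  obtain ⟨d, hd⟩ := Df_mem_range a
  obtain ⟨u, hu⟩ := Df_dvd_toTower_Df a
  have hb : d • b = 0 := by
    refine algebraMap_splittingAlg_injective (cofactorCoeffs a) ?_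
    rw [Algebra.smul_def, map_zero, map_mul, AdjoinRoot.algebraMap_eq, ← toTower_algebraMap, hd, hu,
      mul_comm, ← mul_assoc, hD, zero_mul]
  have hf := coeffPoly_monic a
  have hr := AdjoinRoot.mk_leftInverse hf
  suffices AdjoinRoot.modByMonicHom hf b = 0 by rw [← hr b, this, map_zero]
  ext i
  refine hann _ ?_ ?_
  · have := congrArg (fun y => (AdjoinRoot.modByMonicHom hf y).coeff i) (two_mul b ▸ h₂)
    simpa [two_mul] using this
  · rw [← hd, ← map_mul, mul_comm]
    have := congrArg (fun y => (AdjoinRoot.modByMonicHom hf y).coeff i) hb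
    simp only [map_smul, Polynomial.coeff_smul, map_zero, Polynomial.coeff_zero,
      smul_eq_mul] at this
    rw [this, map_zero]

theorem cofactor_coeff {n : ℕ} (a : Fin (n + 2) → A) :
    (coeffPoly (RootAlg a) (n + 1) (cofactorCoeffs a)).coeff n =
      rootAlgRoot a + rootAlgOf a (a 0) := by
  nontriviality RootAlg a
  have h := congrArg (Polynomial.coeff · (n + 1)) (X_sub_C_root_mul_cofactor a)
  have h₁ := coeffPoly_coeff a 0
  have h₂ := (coeffPoly_monic (cofactorCoeffs a)).coeff_natDegree
  rw [coeffPoly_natDegree] at h₂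
  simp only [Fin.val_zero, Nat.sub_zero] at h₁
  simp only [sub_mul, Polynomial.coeff_sub, Polynomial.coeff_X_mul, Polynomial.coeff_C_mul,
    Polynomial.coeff_map] at h
  rw [h₂, mul_one] at h
  rw [sub_eq_iff_eq_add.1 h, ← h₁]
  exact add_comm _ _

theorem eq_C_of_eval₂_tau_eq {n : ℕ} (a : Fin (n + 2) → A)
    (hann : ∀ b : A, 2 * b = 0 → algebraMap A _ b * Df A (n + 2) a = 0 → b = 0)
    {h : Polynomial A} (hdeg : h.degree < (n + 2 : ℕ))
    (heq : h.eval₂ (algebraMap A _) (tau A (n + 2) a 0) =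
      h.eval₂ (algebraMap A _) (tau A (n + 2) a 1)) : h = Polynomial.C (h.coeff 0) := by
  nontriviality A
  have hcoeff := (Polynomial.degree_lt_iff_coeff_zero _ _).1 hdeg
  set B := RootAlg a
  set g := coeffPoly B (n + 1) (cofactorCoeffs a) with hg
  have hnt : Nontrivial B := (rootAlgOf_injective a).nontrivial
  set h' : Polynomial B := h.map (rootAlgOf a) -
    Polynomial.C (h.eval₂ (rootAlgOf a) (rootAlgRoot a)) with hh'
  have hroot : AdjoinRoot.mk g h' = 0 := by
    have h₁ := congrArg (toTower (cofactorCoeffs a)) (congrArg (toTower a) heq)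
    rw [Polynomial.hom_eval₂, Polynomial.hom_eval₂, Polynomial.hom_eval₂, Polynomial.hom_eval₂,
      toTower_tau_zero, toTower_algebraMap, show (1 : Fin (n + 2)) = Fin.succ 0 from rfl,
      toTower_tau_succ, toTower_tau_zero] at h₁
    have h₂ : (toTower (cofactorCoeffs a)).comp ((toTower a).comp
        (algebraMap A (SplittingAlg A (n + 2) a))) =
        (algebraMap (RootAlg (cofactorCoeffs a)) _).comp
          ((rootAlgOf (cofactorCoeffs a)).comp (rootAlgOf a)) := by
      ext c
      simp only [RingHom.comp_apply, toTower_algebraMap]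
    rw [h₂, ← Polynomial.hom_eval₂, ← Polynomial.hom_eval₂, ← Polynomial.hom_eval₂] at h₁
    have h₃ := algebraMap_splittingAlg_injective _ h₁
    rw [hh', map_sub, AdjoinRoot.mk_C, sub_eq_zero, h₃, ← Polynomial.eval₂_map]
    exact (AdjoinRoot.aeval_eq _).symm
  have hlead : g.coeff (n + 1) = 1 := by
    have := (coeffPoly_monic (cofactorCoeffs a)).coeff_natDegree
    rwa [coeffPoly_natDegree] at this
  have hmul : h' - Polynomial.C (rootAlgOf a (h.coeff (n + 1))) * g = 0 := by
    refine mk_coeffPoly_eq_zero (cofactorCoeffs a) ?_ ?_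
    · rw [Polynomial.degree_lt_iff_coeff_zero]
      intro j hj
      rw [Polynomial.coeff_sub, Polynomial.coeff_C_mul, hh', Polynomial.coeff_sub,
        Polynomial.coeff_C, if_neg (by omega), Polynomial.coeff_map, sub_zero]
      rcases hj.eq_or_lt with rfl | hj
      · rw [hlead, mul_one, sub_self]
      · rw [hcoeff j hj, Polynomial.coeff_eq_zero_of_natDegree_lt (p := g)
          (by rwa [hg, coeffPoly_natDegree]), map_zero, mul_zero, sub_zero]
    · rw [map_sub, hroot, map_mul, AdjoinRoot.mk_self, mul_zero, sub_zero]
  have hn := congrArg (Polynomial.coeff · n) hmul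
  simp only [Polynomial.coeff_sub, Polynomial.coeff_C_mul, Polynomial.coeff_zero] at hn
  rw [hg, cofactor_coeff, hh', Polynomial.coeff_sub, Polynomial.coeff_map] at hn
  have hc : h.coeff (n + 1) = 0 := by
    rcases Nat.eq_zero_or_pos n with rfl | hpos
    · have hlin : h = Polynomial.C (h.coeff 1) * Polynomial.X + Polynomial.C (h.coeff 0) :=
        Polynomial.eq_X_add_C_of_degree_le_one (Order.le_of_lt_succ hdeg)
      rw [Polynomial.coeff_C_zero] at hn
      have h2 : 2 * h.coeff 1 = 0 := by
        refine eq_zero_of_rootAlgOf_add_mul_root a le_rfl (b := h.coeff 1 * a 0) ?_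
        have : h.eval₂ (rootAlgOf a) (rootAlgRoot a) =
            rootAlgOf a (h.coeff 1) * rootAlgRoot a + rootAlgOf a (h.coeff 0) := by
          conv_lhs => rw [hlin]
          simp
        rw [this] at hn
        rw [map_mul, map_mul, map_ofNat]
        linear_combination -hn
      refine hann _ h2 ?_
      have hD : Df A 2 a = tau A 2 a 0 + tau A 2 a 1 := by
        rw [Df, show (Finset.univ.filter fun p : Fin 2 × Fin 2 => p.1 < p.2) = {(0, 1)} by decide,
          Finset.prod_singleton]
      rw [hlin] at heq
      simp only [Polynomial.eval₂_add, Polynomial.eval₂_mul, Polynomial.eval₂_C,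
        Polynomial.eval₂_X] at heq
      have h2' := congrArg (algebraMap A (SplittingAlg A 2 a)) h2
      rw [map_mul, map_ofNat, map_zero] at h2'
      rw [hD]
      linear_combination heq + tau A 2 a 1 * h2'
    · rw [Polynomial.coeff_C, if_neg (by omega)] at hn
      refine eq_zero_of_rootAlgOf_add_mul_root a (by omega)
        (b := h.coeff (n + 1) * a 0 - h.coeff n) ?_
      rw [map_sub, map_mul]
      linear_combination -hn
  rw [hc, map_zero, Polynomial.C_0, zero_mul, sub_zero, hh'] at hmul
  ext j
  rcases Nat.eq_zero_or_pos j with rfl | hj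
  · simp
  · have := congrArg (Polynomial.coeff · j) hmul
    simp only [Polynomial.coeff_sub, Polynomial.coeff_map, Polynomial.coeff_C, hj.ne', if_false,
      sub_zero, Polynomial.coeff_zero] at this
    rw [Polynomial.coeff_C, if_neg hj.ne']
    exact rootAlgOf_injective a (this.trans (map_zero _).symm)

theorem permHom_toTower {n : ℕ} (a : Fin (n + 1) → A) (σ : Equiv.Perm (Fin n))
    (x : SplittingAlg A (n + 1) a) :
    permHom (RootAlg a) n (cofactorCoeffs a) σ (toTower a x) =
      toTower a (permHom A (n + 1) a (Equiv.Perm.decomposeFin.symm (0, σ)) x) := by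
  have h : (permHom (RootAlg a) n (cofactorCoeffs a) σ).toRingHom.comp (toTower a) =
      (toTower a).comp (permHom A (n + 1) a (Equiv.Perm.decomposeFin.symm (0, σ))).toRingHom := by
    refine splitting_ringHom_ext a (fun c => ?_) (fun i => ?_)
    · simp only [RingHom.comp_apply, AlgHom.toRingHom_eq_coe, RingHom.coe_coe, AlgHom.commutes,
        toTower_algebraMap]
    · simp only [RingHom.comp_apply, AlgHom.toRingHom_eq_coe, RingHom.coe_coe, permHom_tau]
      refine Fin.cases ?_ (fun i => ?_) i
      · rw [Equiv.Perm.decomposeFin_symm_apply_zero, toTower_tau_zero, AlgHom.commutes]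
      · rw [Equiv.Perm.decomposeFin_symm_apply_succ, Equiv.swap_self, Equiv.refl_apply,
          toTower_tau_succ, toTower_tau_succ, permHom_tau]
  exact DFunLike.congr_fun h x

theorem mem_range_of_invariant {A : Type*} [CommRing A] {n : ℕ} (a : Fin n → A)
    (hann : ∀ b : A, 2 * b = 0 → algebraMap A (SplittingAlg A n a) b * Df A n a = 0 → b = 0)
    (x : SplittingAlg A n a) (hx : ∀ σ : Equiv.Perm (Fin n), permHom A n a σ x = x) :
    x ∈ Set.range (algebraMap A (SplittingAlg A n a)) := by
  induction n generalizing A with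
  | zero =>
    obtain ⟨p, rfl⟩ := Ideal.Quotient.mk_surjective x
    obtain ⟨c, rfl⟩ := C_surjective (Fin 0) p
    exact ⟨c, rfl⟩
  | succ n ih =>
    rcases subsingleton_or_nontrivial A with hA | hA
    · exact ⟨0, (Module.subsingleton A (SplittingAlg A (n + 1) a)).elim _ _⟩
    obtain ⟨y, hy⟩ := ih (cofactorCoeffs a) (ann_descends a hann) (toTower a x) fun σ => by
      rw [permHom_toTower, hx]
    have hf := coeffPoly_monic a
    set h := AdjoinRoot.modByMonicHom hf y with hh
    have hxh : x = h.eval₂ (algebraMap A _) (tau A (n + 1) a 0) := by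
      apply toTower_injective a
      rw [Polynomial.hom_eval₂, toTower_tau_zero, ← hy,
        show (toTower a).comp (algebraMap A _) =
          (algebraMap (RootAlg a) _).comp (rootAlgOf a) from RingHom.ext (toTower_algebraMap a),
        ← Polynomial.hom_eval₂]
      congr 1
      exact (AdjoinRoot.mk_leftInverse hf y).symm.trans (AdjoinRoot.aeval_eq _).symm
    have hdeg : h.degree < (n + 1 : ℕ) := by
      obtain ⟨p, rfl⟩ := AdjoinRoot.mk_surjective y
      rw [hh, AdjoinRoot.modByMonicHom_mk]
      refine (Polynomial.degree_modByMonic_lt p hf).trans_eq ?_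
      rw [Polynomial.degree_eq_natDegree hf.ne_zero, coeffPoly_natDegree]
    have hC : h = Polynomial.C (h.coeff 0) := by
      rcases n with _ | n
      · exact Polynomial.eq_C_of_degree_le_zero (Order.le_of_lt_succ hdeg)
      · refine eq_C_of_eval₂_tau_eq a hann hdeg ?_
        have := hx (Equiv.swap 0 1)
        rw [hxh, ← AlgHom.coe_toRingHom, Polynomial.hom_eval₂, AlgHom.coe_toRingHom, permHom_tau,
          Equiv.swap_apply_left, AlgHom.comp_algebraMap] at this
        exact this.symm
    exact ⟨h.coeff 0, by rw [hxh, hC]; simp⟩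

end Descent

/-- If every `a ∈ A` with `2·a = 0` and `(algebraMap A A_f a)·D_f = 0` is zero,
then every `S_n`-invariant element of `A_f` lies in the image of `algebraMap A A_f`. -/
theorem invariant_mem_range_of_ann (A : Type*) [CommRing A] (n : ℕ) (hn : 1 ≤ n)
    (a : Fin n → A)
    (hann : ∀ b : A, 2 * b = 0 → algebraMap A (SplittingAlg A n a) b * Df A n a = 0 → b = 0)
    (x : SplittingAlg A n a) (hx : ∀ σ : Equiv.Perm (Fin n), permHom A n a σ x = x) :
    x ∈ Set.range (algebraMap A (SplittingAlg A n a)) := by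
  exact mem_range_of_invariant a hann x hx
end
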